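/- Let T be a finite tree with a distinguished subtree T' containing all non-leaf vertices of T, and suppose T' is properly 2-colored by colors 0 and 1. Let Λ₀ be a disjoint union over the vertices of T' colored 1 of trees Λ_v, one per such vertex. Suppose the Λ_v are indexed so that whenever we add them one at a time following a sequence v₀, v₁, …, v_{m} where each new {v_m} is chosen at minimal T-distance from the previous set and the previously-added set of color-1 vertices is the intersection of a convex subset of T with the color-1 vertices, the new tree Λ_{v_m} intersects the union of the previous trees in exactly one edge. Then the union of all the Λ_v is a tree. -/

import Mathlib

/-- Acyclicity of a subgraph, by edge-separating labellings. -/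
def SepAcyclic {V : Type*} {G : SimpleGraph V} (A : G.Subgraph) : Prop :=
  ∀ u v, A.Adj u v → ∃ f : V → Prop, f u ∧ ¬ f v ∧
    ∀ a b, A.Adj a b → s(a, b) ≠ s(u, v) → (f a ↔ f b)

theorem sepAcyclic_of_acyclic {V : Type*} {G : SimpleGraph V} (A : G.Subgraph)
    (h : A.coe.IsAcyclic) : SepAcyclic A := by
  intro u v huv
  rw [SimpleGraph.isAcyclic_iff_forall_adj_isBridge] at h
  have hb := @h ⟨u, A.edge_vert huv⟩ ⟨v, A.edge_vert huv.symm⟩ huv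
  rw [SimpleGraph.isBridge_iff] at hb
  refine ⟨fun a => ∃ ha : a ∈ A.verts,
    (A.coe.deleteEdges {s(⟨u, A.edge_vert huv⟩, ⟨v, A.edge_vert huv.symm⟩)}).Reachable
      ⟨u, A.edge_vert huv⟩ ⟨a, ha⟩, ⟨_, .refl _⟩, ?_, ?_⟩
  · rintro ⟨_, hr⟩
    exact hb hr
  · have key : ∀ a b, A.Adj a b → s(a, b) ≠ s(u, v) → (∃ ha : a ∈ A.verts,
      (A.coe.deleteEdges {s(⟨u, A.edge_vert huv⟩, ⟨v, A.edge_vert huv.symm⟩)}).Reachable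
      ⟨u, A.edge_vert huv⟩ ⟨a, ha⟩) → (∃ ha : b ∈ A.verts,
      (A.coe.deleteEdges {s(⟨u, A.edge_vert huv⟩, ⟨v, A.edge_vert huv.symm⟩)}).Reachable
      ⟨u, A.edge_vert huv⟩ ⟨b, ha⟩) := by
      rintro a b hab hne ⟨ha, hr⟩
      refine ⟨A.edge_vert hab.symm, hr.trans (SimpleGraph.Adj.reachable ?_)⟩
      rw [SimpleGraph.deleteEdges_adj]
      refine ⟨hab, ?_⟩
      simpa [Sym2.eq_iff] using hne
    intro a b hab hne
    exact ⟨key a b hab hne, key b a hab.symm (by rwa [Sym2.eq_swap])⟩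

theorem acyclic_of_sepAcyclic {V : Type*} {G : SimpleGraph V} (A : G.Subgraph)
    (h : SepAcyclic A) : A.coe.IsAcyclic := by
  rw [SimpleGraph.isAcyclic_iff_forall_adj_isBridge]
  rintro ⟨u, hu⟩ ⟨v, hv⟩ huv
  rw [SimpleGraph.isBridge_iff]
  obtain ⟨f, hfu, hfv, hf⟩ := h u v huv
  rintro ⟨w⟩
  have key : ∀ (a b : A.verts) (w : (A.coe.deleteEdges {s(⟨u, hu⟩, ⟨v, hv⟩)}).Walk a b),
      f a → f b := by
    intro a b w
    induction w with
    | nil => exact id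
    | cons hab _ ih =>
      intro hfa
      rw [SimpleGraph.deleteEdges_adj] at hab
      refine ih ((hf _ _ hab.1 ?_).1 hfa)
      have := hab.2
      intro h'
      apply this
      simpa [Sym2.eq_iff, Subtype.ext_iff] using h'
  exact hfv (key _ _ w hfu)

theorem sep_glue_aux {V : Type*} {G : SimpleGraph V} (A B : G.Subgraph)
    (hA : SepAcyclic A) (hB : SepAcyclic B) (x y : V)
    (hI : ∀ a, a ∈ A.verts → a ∈ B.verts → a = x ∨ a = y)
    (hxA : A.Adj x y) (hxB : B.Adj x y) (u v : V) (huv : A.Adj u v) :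
    ∃ f : V → Prop, f u ∧ ¬ f v ∧
      ∀ a b, (A.Adj a b ∨ B.Adj a b) → s(a, b) ≠ s(u, v) → (f a ↔ f b) := by
  classical
  obtain ⟨f, hfu, hfv, hf⟩ := hA u v huv
  have hg : ∃ g : V → Prop, (∀ a, a ∈ A.verts → a ∈ B.verts → (f a ↔ g a)) ∧
      ∀ a b, B.Adj a b → s(a, b) ≠ s(u, v) → (g a ↔ g b) := by
    by_cases hs : s(x, y) = s(u, v)
    · have huvB : B.Adj u v := by
        rcases Sym2.eq_iff.1 hs with ⟨rfl, rfl⟩ | ⟨rfl, rfl⟩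
        · exact hxB
        · exact hxB.symm
      obtain ⟨g, hgu, hgv, hg⟩ := hB u v huvB
      refine ⟨g, fun a ha hb => ?_, hg⟩
      have : a = u ∨ a = v := by
        rcases Sym2.eq_iff.1 hs with ⟨rfl, rfl⟩ | ⟨rfl, rfl⟩
        · exact hI a ha hb
        · exact (hI a ha hb).symm
      rcases this with rfl | rfl <;> tauto
    · refine ⟨fun _ => f x, fun a ha hb => ?_, fun _ _ _ _ => Iff.rfl⟩
      rcases hI a ha hb with rfl | rfl
      · rfl
      · exact (hf _ _ hxA hs).symm
  obtain ⟨g, hfg, hg⟩ := hg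
  have hhA : ∀ a, a ∈ A.verts → ((if a ∈ A.verts then f a else g a) ↔ f a) := by
    intro a ha; simp [ha]
  have hhB : ∀ a, a ∈ B.verts → ((if a ∈ A.verts then f a else g a) ↔ g a) := by
    intro a hb
    by_cases ha : a ∈ A.verts
    · simp [ha, hfg a ha hb]
    · simp [ha]
  refine ⟨fun a => if a ∈ A.verts then f a else g a, (hhA _ (A.edge_vert huv)).2 hfu,
    fun h => hfv ((hhA _ (A.edge_vert huv.symm)).1 h), ?_⟩
  rintro a b (hab | hab) hne
  · exact (hhA a (A.edge_vert hab)).trans ((hf a b hab hne).trans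
      (hhA b (A.edge_vert hab.symm)).symm)
  · exact (hhB a (B.edge_vert hab)).trans ((hg a b hab hne).trans
      (hhB b (B.edge_vert hab.symm)).symm)

theorem tree_glue {V : Type*} {G : SimpleGraph V} (A B : G.Subgraph)
    (hA : A.coe.IsTree) (hB : B.coe.IsTree) (x y : V)
    (hI : (A ⊓ B).verts = {x, y}) (hxA : A.Adj x y) (hxB : B.Adj x y) :
    (A ⊔ B).coe.IsTree := by
  have hA' := sepAcyclic_of_acyclic A hA.isAcyclic
  have hB' := sepAcyclic_of_acyclic B hB.isAcyclic
  have hI' : ∀ a, a ∈ A.verts → a ∈ B.verts → a = x ∨ a = y := by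
    intro a ha hb
    have : a ∈ (A ⊓ B).verts := ⟨ha, hb⟩
    rw [hI] at this
    simpa using this
  refine ⟨?_, acyclic_of_sepAcyclic _ ?_⟩
  · have := SimpleGraph.Subgraph.connected_sup (H := A) (K := B) ⟨hA.1.preconnected⟩ ⟨hB.1.preconnected⟩
      (by rw [hI]; exact ⟨x, by simp⟩)
    exact this.coe
  · intro u v huv
    rcases huv with huv | huv
    · exact sep_glue_aux A B hA' hB' x y hI' hxA hxB u v huv
    · obtain ⟨f, h1, h2, h3⟩ := sep_glue_aux B A hB' hA' x y
        (fun a h h' => hI' a h' h) hxB hxA u v huv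
      exact ⟨f, h1, h2, fun a b hab hne => h3 a b (Or.symm hab) hne⟩


theorem stmt_19 {VT : Type*} [Fintype VT] (T : SimpleGraph VT) [DecidableRel T.Adj]
    (hT : T.IsTree) (T' : T.Subgraph) (hT' : T'.coe.IsTree)
    (hNonleaf : ∀ v : VT, 2 ≤ T.degree v → v ∈ T'.verts)
    (c : VT → Fin 2) (hc : ∀ u v : VT, T'.Adj u v → c u ≠ c v)
    (m : ℕ) (e : Fin (m + 1) → VT) (he : Function.Injective e)
    (hrange : Set.range e = {v : VT | v ∈ T'.verts ∧ c v = 1})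
    {VG : Type*} (G : SimpleGraph VG) (Λ : Fin (m + 1) → G.Subgraph)
    (hΛtree : ∀ k : Fin (m + 1), (Λ k).coe.IsTree)
    (hOrder : ∀ k l : Fin (m + 1), 0 < k → k ≤ l →
      sInf {d : ℕ | ∃ j : Fin (m + 1), j < k ∧ d = T.dist (e k) (e j)} ≤
      sInf {d : ℕ | ∃ j : Fin (m + 1), j < k ∧ d = T.dist (e l) (e j)})
    (hConvex : ∀ k : Fin (m + 1), ∃ C : Set VT,
      (∀ x ∈ C, ∀ z ∈ C, ∀ y : VT, T.dist x y + T.dist y z = T.dist x z → y ∈ C) ∧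
      {v : VT | ∃ j : Fin (m + 1), j < k ∧ v = e j} =
        C ∩ {v : VT | v ∈ T'.verts ∧ c v = 1})
    (hGlue : ∀ k : Fin (m + 1), 0 < k →
      ∃ x y : VG, x ≠ y ∧
        (Λ k ⊓ ⨆ (j : Fin (m + 1)) (_ : j < k), Λ j).verts = {x, y} ∧
        (Λ k).Adj x y ∧ (⨆ (j : Fin (m + 1)) (_ : j < k), Λ j).Adj x y) :
    (⨆ k : Fin (m + 1), Λ k).coe.IsTree := by
  have key : ∀ n : ℕ, n ≤ m →
      (⨆ (j : Fin (m + 1)) (_ : (j : ℕ) ≤ n), Λ j).coe.IsTree := by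
    intro n
    induction n with
    | zero =>
      intro _
      have : (⨆ (j : Fin (m + 1)) (_ : (j : ℕ) ≤ 0), Λ j) = Λ 0 := by
        apply le_antisymm
        · refine iSup₂_le fun j hj => ?_
          have : j = 0 := Fin.ext (by simpa using hj)
          rw [this]
        · exact le_iSup₂_of_le (0 : Fin (m + 1)) (by simp) le_rfl
      rw [this]
      exact hΛtree 0
    | succ n ih =>
      intro hn
      have ih := ih (by omega)
      let k : Fin (m + 1) := ⟨n + 1, by omega⟩
      obtain ⟨x, y, -, hI, hxA, hxB⟩ := hGlue k (by simp [k, Fin.lt_def])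
      have e1 : (⨆ (j : Fin (m + 1)) (_ : j < k), Λ j)
          = ⨆ (j : Fin (m + 1)) (_ : (j : ℕ) ≤ n), Λ j := by
        have : ∀ j : Fin (m + 1), j < k ↔ (j : ℕ) ≤ n := by
          intro j; simp only [k, Fin.lt_def]; omega
        simp only [this]
      rw [e1] at hI hxB
      have e2 : (⨆ (j : Fin (m + 1)) (_ : (j : ℕ) ≤ n + 1), Λ j)
          = Λ k ⊔ ⨆ (j : Fin (m + 1)) (_ : (j : ℕ) ≤ n), Λ j := by
        apply le_antisymm
        · refine iSup₂_le fun j hj => ?_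
          rcases Nat.lt_or_ge n j with h | h
          · have : j = k := Fin.ext (by simp only [k]; omega)
            rw [this]; exact le_sup_left
          · exact le_sup_of_le_right (le_iSup₂_of_le j h le_rfl)
        · refine sup_le (le_iSup₂_of_le k le_rfl le_rfl) ?_
          exact iSup₂_le fun j hj => le_iSup₂_of_le j (by omega) le_rfl
      rw [e2]
      exact tree_glue _ _ (hΛtree k) ih x y hI hxA hxB
  have e3 : (⨆ k : Fin (m + 1), Λ k) = ⨆ (j : Fin (m + 1)) (_ : (j : ℕ) ≤ m), Λ j := by
    have : ∀ j : Fin (m + 1), (j : ℕ) ≤ m := fun j => by omega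
    simp [this]
  rw [e3]
  exact key m le_rfl
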